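/- arXiv:1708.07680 — 3 statements merged into one kernel-verified Lean document; each statement's English description precedes it below -/
import Mathlib

section
/- Let m ≤ n be natural numbers, f ∈ R_m a polynomial with deg(f) > 0, and p ∈ Inc(ℕ) with p·f ∈ R_n. Let m', n' ∈ ℕ be minimal with f ∈ R_{m'} and p·f ∈ R_{n'}. Then there exists p' ∈ Inc(ℕ)_{m,n} with p'·f = p·f if and only if m − m' ≤ n − n'. -/
open MvPolynomial

/-- The ambient polynomial ring `R = K[x_{i,j} | i ∈ [c], j ∈ ℕ]`
(second variable indices are written `0`-based). -/
abbrev PolyR (K : Type*) [Field K] (c : ℕ) : Type _ := MvPolynomial (Fin c × ℕ) K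

/-- The action of `p : ℕ → ℕ` on variable indices: `x_{i,j} ↦ x_{i,p(j)}`. -/
def incVar (c : ℕ) (p : ℕ → ℕ) : Fin c × ℕ → Fin c × ℕ := fun v => (v.1, p v.2)

/-- The `K`-linear (in fact `K`-algebra) action of `p : ℕ → ℕ` on `R`. -/
noncomputable def incAct (K : Type*) [Field K] (c : ℕ) (p : ℕ → ℕ) :
    PolyR K c →ₐ[K] PolyR K c := rename (incVar c p)

/-- `Inc(ℕ)_{m,n}`: strictly increasing maps sending the first `m` variable indices
into the first `n` variable indices. -/
def IncIn (m n : ℕ) : Set (ℕ → ℕ) := {p | StrictMono p ∧ ∀ j < m, p j < n}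

/-- `R_A`: the polynomials using only variables `x_{i,j}` with `j ∈ A`. -/
def RsetOn (K : Type*) [Field K] (c : ℕ) (A : Set ℕ) : Set (PolyR K c) :=
  (supported K {v : Fin c × ℕ | v.2 ∈ A} : Subalgebra K (PolyR K c))

/-- `R_n`: the polynomials using only the first `n` variable indices. -/
def Rset (K : Type*) [Field K] (c n : ℕ) : Set (PolyR K c) := RsetOn K c {j | j < n}

/-- `J` is an ideal of the subring of `R` with underlying set `A`. -/
def IsIdealOf {K : Type*} [Field K] {c : ℕ} (J A : Set (PolyR K c)) : Prop :=
  J ⊆ A ∧ (0 : PolyR K c) ∈ J ∧ (∀ f ∈ J, ∀ g ∈ J, f + g ∈ J) ∧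
    ∀ a ∈ A, ∀ f ∈ J, a * f ∈ J

/-- The ideal of the subring of `R` with underlying set `A` generated by `S`. -/
def spanIn {K : Type*} [Field K] {c : ℕ} (A S : Set (PolyR K c)) : Set (PolyR K c) :=
  ⋂₀ {J : Set (PolyR K c) | IsIdealOf J A ∧ S ⊆ J}

/-- The set `Inc(ℕ)_{m,n} · S`. -/
def incOrbit (K : Type*) [Field K] (c m n : ℕ) (S : Set (PolyR K c)) : Set (PolyR K c) :=
  {g | ∃ p ∈ IncIn m n, ∃ f ∈ S, g = incAct K c p f}

/-- An `Inc(ℕ)`-invariant ideal chain in `R`. -/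
def IsIncChain (K : Type*) [Field K] (c : ℕ) (J : ℕ → Set (PolyR K c)) : Prop :=
  (∀ n, IsIdealOf (J n) (Rset K c n)) ∧
    ∀ m n, m ≤ n → incOrbit K c m n (J m) ⊆ J n

/-- The set of indices from which on the chain `J` is generated by `Inc(ℕ)`-shifts. -/
def stabSet (K : Type*) [Field K] (c : ℕ) (J : ℕ → Set (PolyR K c)) : Set ℕ :=
  {N | ∀ n, N ≤ n → spanIn (Rset K c n) (incOrbit K c N n (J N)) = J n}

/-- The stability index `Ind(J∘)` of an ideal chain. -/
noncomputable def Ind (K : Type*) [Field K] (c : ℕ) (J : ℕ → Set (PolyR K c)) : ℕ :=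
  sInf (stabSet K c J)

/-- A term order: a total order on monomials (identified with their exponent vectors,
so that multiplication of monomials becomes addition) which respects multiplication and
has the monomial `1` (exponent vector `0`) as least element. -/
structure TermOrder (σ : Type*) where
  le : (σ →₀ ℕ) → (σ →₀ ℕ) → Prop
  refl : ∀ a, le a a
  trans : ∀ a b c, le a b → le b c → le a c
  antisymm : ∀ a b, le a b → le b a → a = b
  total : ∀ a b, le a b ∨ le b a
  add_right : ∀ a b h, le a b → le (a + h) (b + h)
  zero_le : ∀ a, le 0 a

/-- A term order on `R` is `Inc(ℕ)`-compatible if it is preserved by the action of every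
strictly increasing map. -/
def IncCompatible (c : ℕ) (T : TermOrder (Fin c × ℕ)) : Prop :=
  ∀ p : ℕ → ℕ, StrictMono p → ∀ a b, T.le a b →
    T.le (Finsupp.mapDomain (incVar c p) a) (Finsupp.mapDomain (incVar c p) b)

/-- `a` is the exponent vector of the leading monomial of `f` with respect to `T`. -/
def IsLeadMon {K : Type*} [Field K] {c : ℕ} (T : TermOrder (Fin c × ℕ))
    (f : PolyR K c) (a : (Fin c × ℕ) →₀ ℕ) : Prop :=
  a ∈ f.support ∧ ∀ b ∈ f.support, T.le b a

/-- The set of leading monomials of the nonzero elements of `J`. -/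
def leadMonSet (K : Type*) [Field K] (c : ℕ) (T : TermOrder (Fin c × ℕ))
    (J : Set (PolyR K c)) : Set (PolyR K c) :=
  {g | ∃ f ∈ J, f ≠ 0 ∧ ∃ a, IsLeadMon T f a ∧ g = monomial a (1 : K)}

/-- The initial ideal of `J`, as an ideal of `R_A`. -/
def initialOn (K : Type*) [Field K] (c : ℕ) (T : TermOrder (Fin c × ℕ)) (A : Set ℕ)
    (J : Set (PolyR K c)) : Set (PolyR K c) :=
  spanIn (RsetOn K c A) (leadMonSet K c T J)

/-- The chain of initial ideals `in_T(J_1) ⊆ in_T(J_2) ⊆ ...`. -/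
def inChain (K : Type*) [Field K] (c : ℕ) (T : TermOrder (Fin c × ℕ))
    (J : ℕ → Set (PolyR K c)) : ℕ → Set (PolyR K c) :=
  fun n => initialOn K c T {j | j < n} (J n)

/-- `I(J∘)`: the set of stability indices of initial ideal chains of `J` with respect to
`Inc(ℕ)`-compatible term orders. -/
def IndSet (K : Type*) [Field K] (c : ℕ) (J : ℕ → Set (PolyR K c)) : Set ℕ :=
  {N | ∃ T : TermOrder (Fin c × ℕ), IncCompatible c T ∧ Ind K c (inChain K c T J) = N}

/-- `S_n`: bijections of the variable indices fixing all indices outside the first `n`. -/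
def SymN (n : ℕ) : Set (ℕ → ℕ) := {σ | Function.Bijective σ ∧ ∀ i, n ≤ i → σ i = i}

/-- An `S_∞`-invariant ideal chain in `R`. -/
def IsSymChain (K : Type*) [Field K] (c : ℕ) (J : ℕ → Set (PolyR K c)) : Prop :=
  (∀ n, IsIdealOf (J n) (Rset K c n)) ∧
    ∀ m n, m ≤ n → ∀ σ ∈ SymN n, ∀ f ∈ J m, incAct K c σ f ∈ J n

theorem mem_Rset_iff {K : Type*} [Field K] {c k : ℕ} {f : PolyR K c} :
    f ∈ Rset K c k ↔ ∀ v ∈ f.vars, v.2 < k := by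
  change f ∈ supported K _ ↔ _
  rw [mem_supported]
  rfl

theorem mem_vars_incAct_iff {K : Type*} [Field K] {c : ℕ} {q : ℕ → ℕ} (hq : StrictMono q)
    {f : PolyR K c} {w : Fin c × ℕ} :
    w ∈ (incAct K c q f).vars ↔ ∃ v ∈ f.vars, incVar c q v = w := by
  classical
  have hinj : Function.Injective (incVar c q) := fun a b h =>
    Prod.ext (Prod.ext_iff.1 h).1 (hq.injective (Prod.ext_iff.1 h).2)
  unfold incAct
  rw [vars_def, degrees_rename_of_injective hinj, Multiset.mem_toFinset, Multiset.mem_map]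
  simp only [vars_def, Multiset.mem_toFinset]

theorem incAct_congr {K : Type*} [Field K] {c : ℕ} {q r : ℕ → ℕ} {f : PolyR K c}
    (h : ∀ v ∈ f.vars, q v.2 = r v.2) : incAct K c q f = incAct K c r f := by
  refine hom_congr_vars (f₁ := (incAct K c q).toRingHom) (f₂ := (incAct K c r).toRingHom)
    ?_ ?_ rfl
  · ext x
    simp [incAct]
  · intro v hv _
    simp [incAct, incVar, h v hv]

/-- If `R_k` is the smallest of these rings containing a nonconstant `f`, then some variable
with the last index of `R_k` occurs in `f`. -/
theorem exists_mem_vars_of_minimal {K : Type*} [Field K] {c k : ℕ} {f : PolyR K c}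
    (hdeg : 0 < f.totalDegree) (hk : f ∈ Rset K c k ∧ ∀ l, f ∈ Rset K c l → k ≤ l) :
    ∃ v ∈ f.vars, v.2 + 1 = k := by
  by_contra! h
  have hlt := mem_Rset_iff.1 hk.1
  have hle : k ≤ k - 1 := hk.2 _ <| mem_Rset_iff.2 fun v hv => by
    have := hlt v hv
    have := h v hv
    omega
  obtain rfl : k = 0 := by omega
  have hvars : f.vars = ∅ := Finset.eq_empty_of_forall_notMem fun v hv =>
    absurd (hlt v hv) (Nat.not_lt_zero _)
  rw [vars_eq_empty_iff_eq_C] at hvars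
  rw [hvars, totalDegree_C] at hdeg
  exact hdeg.false

/-- A strictly increasing map sends the last variable index of `f` to that of its image. -/
theorem add_one_eq_of_minimal_incAct {K : Type*} [Field K] {c k : ℕ} {f : PolyR K c}
    {q : ℕ → ℕ} (hq : StrictMono q) {v : Fin c × ℕ} (hv : v ∈ f.vars)
    (hf : f ∈ Rset K c (v.2 + 1))
    (hk : incAct K c q f ∈ Rset K c k ∧ ∀ l, incAct K c q f ∈ Rset K c l → k ≤ l) :
    q v.2 + 1 = k := by
  refine le_antisymm
    (mem_Rset_iff.1 hk.1 _ ((mem_vars_incAct_iff hq).2 ⟨v, hv, rfl⟩)) (hk.2 _ ?_)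
  rw [mem_Rset_iff]
  intro w hw
  obtain ⟨u, hu, rfl⟩ := (mem_vars_incAct_iff hq).1 hw
  exact Nat.lt_succ_of_le (hq.monotone (Nat.le_of_lt_succ (mem_Rset_iff.1 hf u hu)))

/-- **Lemma (Statement 3).** Let `m ≤ n`, `f ∈ R_m` with `deg f > 0`, and `p ∈ Inc(ℕ)` with
`p·f ∈ R_n`. Let `m', n'` be minimal with `f ∈ R_{m'}` and `p·f ∈ R_{n'}`. Then there is
`p' ∈ Inc(ℕ)_{m,n}` with `p'·f = p·f` if and only if `m − m' ≤ n − n'`. -/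
theorem exists_incIn_act_eq_iff (K : Type*) [Field K] (c : ℕ) (hc : 0 < c)
    (m n : ℕ) (hmn : m ≤ n)
    (f : PolyR K c) (hf : f ∈ Rset K c m) (hdeg : 0 < f.totalDegree)
    (p : ℕ → ℕ) (hp : StrictMono p) (hpf : incAct K c p f ∈ Rset K c n)
    (m' n' : ℕ)
    (hm' : f ∈ Rset K c m' ∧ ∀ k, f ∈ Rset K c k → m' ≤ k)
    (hn' : incAct K c p f ∈ Rset K c n' ∧ ∀ k, incAct K c p f ∈ Rset K c k → n' ≤ k) :
    (∃ p' ∈ IncIn m n, incAct K c p' f = incAct K c p f) ↔ m - m' ≤ n - n' := by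
  obtain ⟨v, hv, rfl⟩ := exists_mem_vars_of_minimal hdeg hm'
  have hpv := add_one_eq_of_minimal_incAct hp hv hm'.1 hn'
  have hvm : v.2 + 1 ≤ m := hm'.2 m hf
  have hnn : n' ≤ n := hn'.2 n hpf
  constructor
  · rintro ⟨q, ⟨hq, hqn⟩, hqf⟩
    have hqv := add_one_eq_of_minimal_incAct hq hv hm'.1 (hqf.symm ▸ hn')
    have hlast : q (m - 1) < n := hqn _ (by omega)
    have hgrow := hq.add_le_nat (m - 1 - v.2) v.2
    rw [Nat.sub_add_cancel (by omega)] at hgrow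
    omega
  · intro h
    refine ⟨fun j => if j ≤ v.2 then p j else p v.2 + (j - v.2), ⟨?_, ?_⟩, ?_⟩
    · refine strictMono_nat_of_lt_succ fun j => ?_
      have hstep := hp (Nat.lt_succ_self j)
      rcases lt_trichotomy j v.2 with hj | rfl | hj
      · simpa [hj.le, Nat.succ_le_of_lt hj] using hstep
      · simp
      · rw [if_neg (by omega), if_neg (by omega)]
        omega
    · intro j hj
      dsimp only
      split_ifs with hjv
      · have := hp.monotone hjv
        omega
      · omega
    · exact incAct_congr fun u hu =>
        if_pos (Nat.le_of_lt_succ (mem_Rset_iff.1 hm'.1 u hu))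
end

section
/- Let i₁ ≤ i₂ ≤ ... be an ascending sequence of natural numbers and let g_{i_n} ∈ R_{i_n} be monomials for each n. Then there exist indices j < k such that g_{i_k} is contained in the ideal ⟨Inc(ℕ)_{i_j,i_k}·g_{i_j}⟩ of R_{i_k}. -/
open MvPolynomial

theorem monomial_mem_Rset {K : Type*} [Field K] {c n : ℕ} {a : (Fin c × ℕ) →₀ ℕ} :
    monomial a (1 : K) ∈ Rset K c n ↔ ∀ u t, n ≤ t → a (u, t) = 0 := by
  change monomial a (1 : K) ∈ supported K {v : Fin c × ℕ | v.2 ∈ {j | j < n}} ↔ _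
  rw [mem_supported, vars_monomial one_ne_zero]
  constructor
  · intro h u t ht
    by_contra hne
    have h1 : t < n := h (Finset.mem_coe.2 (Finsupp.mem_support_iff.2 hne))
    omega
  · rintro h ⟨u, t⟩ hv
    by_contra hne
    exact Finsupp.mem_support_iff.1 (Finset.mem_coe.1 hv) (h u t (not_lt.1 hne))

/-- Higman's lemma for finite words given as initial segments of functions on `ℕ`. -/
theorem exists_lt_strictMono_le {α : Type*} [Preorder α] [WellQuasiOrderedLE α]
    (i : ℕ → ℕ) (w : ℕ → ℕ → α) :
    ∃ j k, j < k ∧ ∃ p ∈ IncIn (i j) (i k), ∀ t < i j, w j t ≤ w k (p t) := by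
  have hs : (Set.univ : Set α).PartiallyWellOrderedOn (· ≤ ·) :=
    Set.partiallyWellOrderedOn_univ_iff.2 wellQuasiOrdered_le
  obtain ⟨j, k, hjk, h⟩ := Set.PartiallyWellOrderedOn.partiallyWellOrderedOn_sublistForall₂ _ hs
    (fun n => ⟨(List.range (i n)).map (w n), fun _ _ => Set.mem_univ _⟩)
  obtain ⟨l, hl, hsub⟩ := List.sublistForall₂_iff.1 h
  obtain ⟨p, hp⟩ := List.sublist_iff_exists_orderEmbedding_getElem?_eq.1 hsub
  have hlen : l.length = i j := by simpa using hl.length_eq.symm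
  have key : ∀ t < i j, p t < i k ∧ w j t ≤ w k (p t) := by
    intro t ht
    have hpt := hp t
    rw [List.getElem?_eq_getElem (hlen ▸ ht), eq_comm, List.getElem?_eq_some_iff] at hpt
    obtain ⟨hlt, heq⟩ := hpt
    have hr := hl.get (i := t) (by simpa using ht) (hlen ▸ ht)
    simp only [List.get_eq_getElem, List.getElem_map, List.getElem_range] at hr heq
    exact ⟨by simpa using hlt, heq ▸ hr⟩
  exact ⟨j, k, hjk, p, ⟨p.strictMono, fun t ht => (key t ht).1⟩, fun t ht => (key t ht).2⟩

theorem mapDomain_incVar_le {c m : ℕ} {p : ℕ → ℕ} (hp : StrictMono p)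
    {a b : (Fin c × ℕ) →₀ ℕ} (ha : ∀ u t, m ≤ t → a (u, t) = 0)
    (h : ∀ t < m, ∀ u, a (u, t) ≤ b (u, p t)) :
    Finsupp.mapDomain (incVar c p) a ≤ b := by
  have hinj : Function.Injective (incVar c p) := by
    rintro ⟨u, t⟩ ⟨u', t'⟩ huv
    simp only [incVar, Prod.mk.injEq] at huv
    exact Prod.ext huv.1 (hp.injective huv.2)
  intro v
  by_cases hv : v ∈ Set.range (incVar c p)
  · obtain ⟨⟨u, t⟩, rfl⟩ := hv
    rw [Finsupp.mapDomain_apply hinj]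
    rcases lt_or_ge t m with ht | ht
    · exact h t ht u
    · simp [ha u t ht]
  · simp [Finsupp.mapDomain_of_notMem_range _ _ hv]

/-- **Lemma (Statement 4).** Let `i₁ ≤ i₂ ≤ ...` be an ascending sequence of natural numbers
and let `g_{i_n} ∈ R_{i_n}` be monomials. Then there are indices `j < k` such that `g_{i_k}`
lies in the ideal `⟨Inc(ℕ)_{i_j,i_k} · g_{i_j}⟩` of `R_{i_k}`. -/
theorem exists_lt_mem_span_incOrbit (K : Type*) [Field K] (c : ℕ) (hc : 0 < c)
    (i : ℕ → ℕ) (hi : Monotone i)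
    (g : ℕ → PolyR K c) (hg : ∀ n, g n ∈ Rset K c (i n))
    (hmono : ∀ n, ∃ a : (Fin c × ℕ) →₀ ℕ, g n = monomial a (1 : K)) :
    ∃ j k, j < k ∧ g k ∈ spanIn (Rset K c (i k)) (incOrbit K c (i j) (i k) {g j}) := by
  choose a ha using hmono
  have hzero : ∀ n u t, i n ≤ t → a n (u, t) = 0 := fun n =>
    monomial_mem_Rset.1 (ha n ▸ hg n)
  obtain ⟨j, k, hjk, p, hp, hle⟩ := exists_lt_strictMono_le i (fun n t (u : Fin c) => a n (u, t))
  refine ⟨j, k, hjk, ?_⟩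
  rintro J ⟨⟨-, -, -, hmul⟩, hJ⟩
  have hdvd := mapDomain_incVar_le hp.1 (hzero j) hle
  have horb : monomial (Finsupp.mapDomain (incVar c p) (a j)) (1 : K) ∈ J :=
    hJ ⟨p, hp, g j, rfl, by rw [ha j, incAct, rename_monomial]⟩
  have hcof : monomial (a k - Finsupp.mapDomain (incVar c p) (a j)) (1 : K) ∈ Rset K c (i k) :=
    monomial_mem_Rset.2 fun u t ht => by simp [hzero k u t ht]
  have hmem := hmul _ hcof _ horb
  rwa [monomial_mul, one_mul, tsub_add_cancel_of_le hdvd, ← ha k] at hmem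
end

section
/- Let J∘ = J₁ ⊆ J₂ ⊆ ... be an Inc(ℕ)-invariant ideal chain in R and N ≥ Ind(J∘). Then for every Inc(ℕ)-compatible term order ⪯ on R, the identity in_⪯(J_{2N}) = ⟨Inc(ℕ)_{N,2N}·in_⪯(J_N)⟩_{R_{2N}} implies Ind(in_⪯(J∘)) ≤ 2N. -/
open MvPolynomial

section Helpers

variable {K : Type*} [Field K] {c : ℕ}

/-- The monomial with exponent vector `a` lies in `R_n`. -/
def ExpIn (n : ℕ) (a : (Fin c × ℕ) →₀ ℕ) : Prop := ∀ v, a v ≠ 0 → v.2 < n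

lemma ExpIn.mono {n : ℕ} {a b : (Fin c × ℕ) →₀ ℕ} (hb : ExpIn n b) (h : a ≤ b) : ExpIn n a :=
  fun v hv => hb v fun h0 => hv (Nat.le_zero.1 (h0 ▸ h v))

lemma ExpIn.add {n : ℕ} {a b : (Fin c × ℕ) →₀ ℕ} (ha : ExpIn n a) (hb : ExpIn n b) :
    ExpIn n (a + b) := by
  intro v hv
  by_cases h : a v = 0
  · exact hb v (by simpa [h] using hv)
  · exact ha v h

lemma ExpIn.sup {n : ℕ} {a b : (Fin c × ℕ) →₀ ℕ} (ha : ExpIn n a) (hb : ExpIn n b) :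
    ExpIn n (a ⊔ b) := by
  intro v hv
  by_cases h : a v = 0
  · exact hb v (by simpa [h] using hv)
  · exact ha v h

lemma incVar_injective {p : ℕ → ℕ} (hp : StrictMono p) : Function.Injective (incVar c p) := by
  rintro ⟨i, j⟩ ⟨i', j'⟩ h
  simp only [incVar, Prod.mk.injEq] at h
  exact Prod.ext h.1 (hp.injective h.2)

lemma mapDomain_incVar_eq_zero {p : ℕ → ℕ} {a : (Fin c × ℕ) →₀ ℕ} {v : Fin c × ℕ}
    (hv : v ∉ Set.range (incVar c p)) : Finsupp.mapDomain (incVar c p) a v = 0 :=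
  Finsupp.mapDomain_of_notMem_range _ _ hv

lemma ExpIn.mapDomain {m n : ℕ} {p : ℕ → ℕ} (hp : p ∈ IncIn m n) {a : (Fin c × ℕ) →₀ ℕ}
    (ha : ExpIn m a) : ExpIn n (Finsupp.mapDomain (incVar c p) a) := by
  intro v hv
  by_cases h : v ∈ Set.range (incVar c p)
  · obtain ⟨w, rfl⟩ := h
    rw [Finsupp.mapDomain_apply (incVar_injective hp.1)] at hv
    exact hp.2 _ (ha w hv)
  · exact absurd (mapDomain_incVar_eq_zero h) hv

lemma mem_Rset_iff_s6 {n : ℕ} {f : PolyR K c} : f ∈ Rset K c n ↔ ∀ a ∈ f.support, ExpIn n a := by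
  unfold Rset RsetOn
  rw [SetLike.mem_coe, mem_supported]
  constructor
  · intro h a ha v hv
    exact h ((mem_vars_iff_mem_support _).2 ⟨a, ha, Finsupp.mem_support_iff.2 hv⟩)
  · intro h v hv
    obtain ⟨a, ha, hva⟩ := (mem_vars_iff_mem_support _).1 hv
    exact h a ha v (Finsupp.mem_support_iff.1 hva)

lemma monomial_mem_Rset_s6 {n : ℕ} {a : (Fin c × ℕ) →₀ ℕ} (ha : ExpIn n a) (r : K) :
    monomial a r ∈ Rset K c n :=
  mem_Rset_iff_s6.2 fun b hb => by
    obtain rfl := Finset.mem_singleton.1 (support_monomial_subset hb)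
    exact ha

lemma isIdealOf_Rset (n : ℕ) : IsIdealOf (Rset K c n) (Rset K c n) :=
  ⟨subset_rfl, Subalgebra.zero_mem _, fun _ hf _ hg => Subalgebra.add_mem _ hf hg,
    fun _ ha _ hf => Subalgebra.mul_mem _ ha hf⟩

lemma subset_spanIn (A S : Set (PolyR K c)) : S ⊆ spanIn A S :=
  fun _ hx _ hJ => hJ.2 hx

lemma spanIn_subset {A S J : Set (PolyR K c)} (hJ : IsIdealOf J A) (h : S ⊆ J) :
    spanIn A S ⊆ J := fun _ hx => hx J ⟨hJ, h⟩

lemma isIdealOf_spanIn {n : ℕ} {S : Set (PolyR K c)} (hS : S ⊆ Rset K c n) :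
    IsIdealOf (spanIn (Rset K c n) S) (Rset K c n) :=
  ⟨spanIn_subset (isIdealOf_Rset n) hS, fun _ hJ => hJ.1.2.1,
    fun f hf g hg J hJ => hJ.1.2.2.1 f (hf J hJ) g (hg J hJ),
    fun a ha f hf J hJ => hJ.1.2.2.2 a ha f (hf J hJ)⟩

lemma IsIdealOf.smul_mem {n : ℕ} {J : Set (PolyR K c)} (hJ : IsIdealOf J (Rset K c n))
    (r : K) {f : PolyR K c} (hf : f ∈ J) : r • f ∈ J := by
  rw [smul_eq_C_mul]
  exact hJ.2.2.2 _ (Subalgebra.algebraMap_mem _ r) f hf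

lemma IsIdealOf.sub_smul_mem {n : ℕ} {J : Set (PolyR K c)} (hJ : IsIdealOf J (Rset K c n))
    (r : K) {f g : PolyR K c} (hf : f ∈ J) (hg : g ∈ J) : f - r • g ∈ J := by
  rw [sub_eq_add_neg, ← neg_smul]
  exact hJ.2.2.1 _ hf _ (hJ.smul_mem _ hg)

lemma mem_support_incAct {p : ℕ → ℕ} (hp : StrictMono p) {f : PolyR K c}
    {a : (Fin c × ℕ) →₀ ℕ} :
    a ∈ (incAct K c p f).support ↔ ∃ b ∈ f.support, Finsupp.mapDomain (incVar c p) b = a := by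
  classical
  rw [incAct, support_rename_of_injective (incVar_injective hp), Finset.mem_image]

lemma incAct_mem_Rset {m n : ℕ} {p : ℕ → ℕ} (hp : p ∈ IncIn m n) {f : PolyR K c}
    (hf : f ∈ Rset K c m) : incAct K c p f ∈ Rset K c n := by
  rw [mem_Rset_iff_s6] at hf ⊢
  intro a ha
  obtain ⟨b, hb, rfl⟩ := (mem_support_incAct hp.1).1 ha
  exact (hf b hb).mapDomain hp

lemma incAct_incAct (p q : ℕ → ℕ) (f : PolyR K c) :
    incAct K c p (incAct K c q f) = incAct K c (p ∘ q) f := by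
  simp only [incAct, rename_rename]
  rfl

lemma mapDomain_incVar_comp (p q : ℕ → ℕ) (a : (Fin c × ℕ) →₀ ℕ) :
    Finsupp.mapDomain (incVar c p) (Finsupp.mapDomain (incVar c q) a) =
      Finsupp.mapDomain (incVar c (p ∘ q)) a := by
  rw [← Finsupp.mapDomain_comp]
  rfl

lemma incAct_monomial (p : ℕ → ℕ) (a : (Fin c × ℕ) →₀ ℕ) (r : K) :
    incAct K c p (monomial a r) = monomial (Finsupp.mapDomain (incVar c p) a) r :=
  rename_monomial _ _ _

lemma mapDomain_incVar_congr {m : ℕ} {p q : ℕ → ℕ} (h : ∀ j < m, p j = q j)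
    {a : (Fin c × ℕ) →₀ ℕ} (ha : ExpIn m a) :
    Finsupp.mapDomain (incVar c p) a = Finsupp.mapDomain (incVar c q) a :=
  Finsupp.mapDomain_congr fun v hv => by
    simp only [incVar, h _ (ha v (Finsupp.mem_support_iff.1 hv))]

lemma incAct_congr_s6 {m : ℕ} {p q : ℕ → ℕ} (h : ∀ j < m, p j = q j) {f : PolyR K c}
    (hf : f ∈ Rset K c m) : incAct K c p f = incAct K c q f := by
  rw [mem_Rset_iff_s6] at hf
  rw [f.as_sum, map_sum, map_sum]
  refine Finset.sum_congr rfl fun a ha => ?_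
  rw [incAct_monomial, incAct_monomial, mapDomain_incVar_congr h (hf a ha)]

lemma incIn_comp {l m n : ℕ} {s p : ℕ → ℕ} (hs : s ∈ IncIn m n) (hp : p ∈ IncIn l m) :
    s ∘ p ∈ IncIn l n :=
  ⟨hs.1.comp hp.1, fun j hj => hs.2 _ (hp.2 j hj)⟩

/-- Strictly increasing maps from `[m]` whose images lie in a common subset of `[n]` with `M`
elements factor through the enumeration of this subset. -/
lemma exists_factor {M n : ℕ} (S : Finset ℕ) (hS : S ⊆ Finset.range n) (hM : S.card = M) :
    ∃ s ∈ IncIn M n, ∀ m p, p ∈ IncIn m n → (∀ j < m, p j ∈ S) →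
      ∃ p' ∈ IncIn m M, ∀ j < m, p j = (s ∘ p') j := by
  classical
  let P : ℕ → Prop := fun j => j ∈ S ∨ n ≤ j
  have hinf : (Set.ofPred P).Infinite := (Set.Ici_infinite n).mono fun j hj => Or.inr hj
  have hcount : Nat.count P n = M := by
    rw [Nat.count_eq_card_filter_range, ← hM]
    congr 1
    ext j
    simp only [Finset.mem_filter, Finset.mem_range, P]
    constructor
    · rintro ⟨h1, h2⟩
      exact h2.resolve_right (by omega)
    · exact fun h => ⟨Finset.mem_range.1 (hS h), Or.inl h⟩
  refine ⟨Nat.nth P, ⟨Nat.nth_strictMono hinf, fun j hj =>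
    Nat.nth_lt_of_lt_count (by rwa [hcount])⟩, fun m p hp hpS => ?_⟩
  have hlt : ∀ j < m, Nat.count P (p j) < M := fun j hj => by
    rw [← hcount]
    exact Nat.count_strict_mono (Or.inl (hpS j hj)) (hp.2 j hj)
  refine ⟨fun j => if j < m then Nat.count P (p j) else M + j, ⟨?_, ?_⟩, ?_⟩
  · intro i j hij
    dsimp only
    by_cases hj : j < m
    · have hi : i < m := hij.trans hj
      rw [if_pos hi, if_pos hj]
      exact Nat.count_strict_mono (Or.inl (hpS i hi)) (hp.1 hij)
    · rw [if_neg hj]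
      by_cases hi : i < m
      · rw [if_pos hi]
        have := hlt i hi
        omega
      · rw [if_neg hi]
        omega
  · intro j hj
    simpa only [if_pos hj] using hlt j hj
  · intro j hj
    simp only [Function.comp, if_pos hj]
    exact (Nat.nth_count (p := P) (Or.inl (hpS j hj))).symm

lemma exists_common_factor {m M n : ℕ} {p q : ℕ → ℕ} (hp : p ∈ IncIn m n) (hq : q ∈ IncIn m n)
    (hM : 2 * m ≤ M) (hn : M ≤ n) :
    ∃ s ∈ IncIn M n, ∃ p' ∈ IncIn m M, ∃ q' ∈ IncIn m M,
      (∀ j < m, p j = (s ∘ p') j) ∧ ∀ j < m, q j = (s ∘ q') j := by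
  classical
  let S₀ := (Finset.range m).image p ∪ (Finset.range m).image q
  have hcard : S₀.card ≤ M := by
    have h1 := Finset.card_union_le ((Finset.range m).image p) ((Finset.range m).image q)
    have h2 := Finset.card_image_le (s := Finset.range m) (f := p)
    have h3 := Finset.card_image_le (s := Finset.range m) (f := q)
    rw [Finset.card_range] at h2 h3
    simp only [S₀]
    omega
  have hsub : S₀ ⊆ Finset.range n := by
    intro x hx
    simp only [S₀, Finset.mem_union, Finset.mem_image, Finset.mem_range] at hx ⊢
    rcases hx with ⟨j, hj, rfl⟩ | ⟨j, hj, rfl⟩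
    exacts [hp.2 j hj, hq.2 j hj]
  obtain ⟨S, hS₀, hS, hSM⟩ :=
    Finset.exists_subsuperset_card_eq hsub hcard (by simpa using hn)
  obtain ⟨s, hs, hfac⟩ := exists_factor S hS hSM
  obtain ⟨p', hp', hpp⟩ := hfac m p hp fun j hj =>
    hS₀ (Finset.mem_union_left _ (Finset.mem_image_of_mem _ (Finset.mem_range.2 hj)))
  obtain ⟨q', hq', hqq⟩ := hfac m q hq fun j hj =>
    hS₀ (Finset.mem_union_right _ (Finset.mem_image_of_mem _ (Finset.mem_range.2 hj)))
  exact ⟨s, hs, p', hp', q', hq', hpp, hqq⟩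

lemma exists_incIn_factor {m M n : ℕ} {p : ℕ → ℕ} (hp : p ∈ IncIn m n) (hM : m ≤ M)
    (hn : M ≤ n) :
    ∃ s ∈ IncIn M n, ∃ p' ∈ IncIn m M, ∀ j < m, p j = (s ∘ p') j := by
  classical
  have hsub : (Finset.range m).image p ⊆ Finset.range n := by
    intro x hx
    simp only [Finset.mem_image, Finset.mem_range] at hx ⊢
    obtain ⟨j, hj, rfl⟩ := hx
    exact hp.2 j hj
  have hcard : ((Finset.range m).image p).card ≤ M :=
    Finset.card_image_le.trans (by simpa using hM)
  obtain ⟨S, hS₀, hS, hSM⟩ :=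
    Finset.exists_subsuperset_card_eq hsub hcard (by simpa using hn)
  obtain ⟨s, hs, hfac⟩ := exists_factor S hS hSM
  obtain ⟨p', hp', hpp⟩ := hfac m p hp fun j hj =>
    hS₀ (Finset.mem_image_of_mem _ (Finset.mem_range.2 hj))
  exact ⟨s, hs, p', hp', hpp⟩

lemma incOrbit_subset_Rset {m n : ℕ} {S : Set (PolyR K c)} (hS : S ⊆ Rset K c m) :
    incOrbit K c m n S ⊆ Rset K c n := by
  rintro _ ⟨p, hp, f, hf, rfl⟩
  exact incAct_mem_Rset hp (hS hf)

lemma stabSet_mono {J : ℕ → Set (PolyR K c)} (hJ : IsIncChain K c J) {M N : ℕ}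
    (hM : M ∈ stabSet K c J) (hMN : M ≤ N) : N ∈ stabSet K c J := by
  intro n hn
  refine Set.Subset.antisymm (spanIn_subset (hJ.1 n) (hJ.2 N n hn)) ?_
  rw [← hM n (hMN.trans hn)]
  refine spanIn_subset (isIdealOf_spanIn (incOrbit_subset_Rset (hJ.1 N).1)) ?_
  rintro _ ⟨p, hp, f, hf, rfl⟩
  obtain ⟨s, hs, p', hp', h⟩ := exists_incIn_factor hp hMN hn
  refine subset_spanIn _ _ ⟨s, hs, incAct K c p' f, hJ.2 M N hMN ⟨p', hp', f, hf, rfl⟩, ?_⟩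
  rw [incAct_incAct, incAct_congr_s6 h ((hJ.1 M).1 hf)]

namespace TermOrder

lemma le_of_le {σ : Type*} (T : TermOrder σ) {a b : σ →₀ ℕ} (h : a ≤ b) : T.le a b := by
  have := T.add_right 0 (b - a) a (T.zero_le _)
  rwa [zero_add, tsub_add_cancel_of_le h] at this

lemma add_left {σ : Type*} (T : TermOrder σ) {a b : σ →₀ ℕ} (k : σ →₀ ℕ) (h : T.le a b) :
    T.le (k + a) (k + b) := by
  rw [add_comm k, add_comm k]
  exact T.add_right _ _ _ h

/-- The strict order associated with a term order. -/
def lt {σ : Type*} (T : TermOrder σ) (a b : σ →₀ ℕ) : Prop := T.le a b ∧ a ≠ b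

lemma lt_of_le_of_lt {σ : Type*} (T : TermOrder σ) {a b d : σ →₀ ℕ} (h : T.le a b)
    (h' : T.lt b d) : T.lt a d :=
  ⟨T.trans _ _ _ h h'.1, fun e => h'.2 (T.antisymm _ _ h'.1 (e ▸ h))⟩

lemma exists_max {σ : Type*} (T : TermOrder σ) (s : Finset (σ →₀ ℕ)) (hs : s.Nonempty) :
    ∃ a ∈ s, ∀ b ∈ s, T.le b a := by
  classical
  induction hs using Finset.Nonempty.cons_induction with
  | singleton a => exact ⟨a, by simp, by simp [T.refl]⟩
  | cons a s ha hs ih =>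
    obtain ⟨m, hm, hmax⟩ := ih
    rcases T.total a m with h | h
    · exact ⟨m, by simp [hm], by simpa using ⟨h, hmax⟩⟩
    · exact ⟨a, by simp, by simpa [T.refl] using fun b hb => T.trans _ _ _ (hmax b hb) h⟩

end TermOrder

lemma isPWO_expIn (n : ℕ) : {a : (Fin c × ℕ) →₀ ℕ | ExpIn n a}.IsPWO := by
  let e : Fin c × Fin n → Fin c × ℕ := fun v => (v.1, v.2)
  have he : Function.Injective e := by
    rintro ⟨i, j⟩ ⟨i', j'⟩ h
    simp only [e, Prod.mk.injEq] at h
    exact Prod.ext h.1 (Fin.ext h.2)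
  have h := (Set.isPWO_of_wellQuasiOrderedLE
    (Set.univ : Set ((Fin c × Fin n) →₀ ℕ))).image_of_monotone
      (Finsupp.mapDomain_mono (f := e) (α := ℕ))
  refine Set.IsPWO.mono h fun a ha => ⟨a.comapDomain e he.injOn, trivial, ?_⟩
  refine Finsupp.mapDomain_comapDomain _ he _ fun v hv => ?_
  exact ⟨(v.1, ⟨v.2, ha v (Finsupp.mem_support_iff.1 hv)⟩), rfl⟩

/-- A term order is well-founded on the monomials of `R_n`. -/
lemma wellFoundedOn_lt (T : TermOrder (Fin c × ℕ)) (n : ℕ) :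
    {a : (Fin c × ℕ) →₀ ℕ | ExpIn n a}.WellFoundedOn T.lt := by
  have : IsStrictOrder ((Fin c × ℕ) →₀ ℕ) T.lt :=
    { irrefl := fun a h => h.2 rfl
      trans := fun a b d h h' => T.lt_of_le_of_lt h.1 h' }
  rw [Set.wellFoundedOn_iff_no_descending_seq]
  intro f hf
  obtain ⟨i, j, hij, hle⟩ := isPWO_expIn n (fun k => ⟨f k, hf k⟩)
  have h : T.lt (f j) (f i) := f.map_rel_iff.2 hij
  exact h.2 (T.antisymm _ _ h.1 (T.le_of_le hle))

lemma expIn_induction (T : TermOrder (Fin c × ℕ)) (n : ℕ) {Q : ((Fin c × ℕ) →₀ ℕ) → Prop}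
    (h : ∀ a, ExpIn n a → (∀ b, ExpIn n b → T.lt b a → Q b) → Q a)
    (a : (Fin c × ℕ) →₀ ℕ) (ha : ExpIn n a) : Q a :=
  (wellFoundedOn_lt T n).induction (s := {a | ExpIn n a}) ha fun a ha ih => h a ha ih

lemma exists_isLeadMon (T : TermOrder (Fin c × ℕ)) {f : PolyR K c} (hf : f ≠ 0) :
    ∃ a, IsLeadMon T f a :=
  T.exists_max f.support (Finset.nonempty_iff_ne_empty.2 (by simpa using hf))

lemma IsLeadMon.unique {T : TermOrder (Fin c × ℕ)} {f : PolyR K c}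
    {a b : (Fin c × ℕ) →₀ ℕ} (ha : IsLeadMon T f a) (hb : IsLeadMon T f b) : a = b :=
  T.antisymm _ _ (hb.2 a ha.1) (ha.2 b hb.1)

lemma IsLeadMon.ne_zero {T : TermOrder (Fin c × ℕ)} {f : PolyR K c}
    {a : (Fin c × ℕ) →₀ ℕ} (ha : IsLeadMon T f a) : f ≠ 0 := by
  rintro rfl
  simpa using ha.1

lemma IsLeadMon.incAct {T : TermOrder (Fin c × ℕ)} (hT : IncCompatible c T) {f : PolyR K c}
    {a : (Fin c × ℕ) →₀ ℕ} (ha : IsLeadMon T f a) {p : ℕ → ℕ} (hp : StrictMono p) :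
    IsLeadMon T (incAct K c p f) (Finsupp.mapDomain (incVar c p) a) := by
  refine ⟨(mem_support_incAct hp).2 ⟨a, ha.1, rfl⟩, fun b hb => ?_⟩
  obtain ⟨d, hd, rfl⟩ := (mem_support_incAct hp).1 hb
  exact hT p hp _ _ (ha.2 d hd)

lemma exists_of_mem_support_monomial_mul {k a : (Fin c × ℕ) →₀ ℕ} {r : K} {f : PolyR K c}
    (ha : a ∈ (monomial k r * f).support) : ∃ b ∈ f.support, k + b = a := by
  classical
  obtain ⟨x, hx, b, hb, rfl⟩ := Finset.mem_add.1 (support_mul _ _ ha)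
  obtain rfl := Finset.mem_singleton.1 (support_monomial_subset hx)
  exact ⟨b, hb, rfl⟩

lemma IsLeadMon.monomial_mul {T : TermOrder (Fin c × ℕ)} {f : PolyR K c}
    {a : (Fin c × ℕ) →₀ ℕ} (ha : IsLeadMon T f a) (k : (Fin c × ℕ) →₀ ℕ) :
    IsLeadMon T (monomial k 1 * f) (k + a) := by
  refine ⟨?_, fun b hb => ?_⟩
  · rw [mem_support_iff, coeff_monomial_mul, one_mul]
    exact mem_support_iff.1 ha.1
  · obtain ⟨d, hd, rfl⟩ := exists_of_mem_support_monomial_mul hb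
    exact T.add_left k (ha.2 d hd)

lemma leadMonSet_subset_Rset (T : TermOrder (Fin c × ℕ)) {n : ℕ} {J : Set (PolyR K c)}
    (hJ : J ⊆ Rset K c n) : leadMonSet K c T J ⊆ Rset K c n := by
  rintro _ ⟨f, hf, -, a, ha, rfl⟩
  exact monomial_mem_Rset_s6 (mem_Rset_iff_s6.1 (hJ hf) a ha.1) 1

lemma isIdealOf_inChain (T : TermOrder (Fin c × ℕ)) {J : ℕ → Set (PolyR K c)}
    (hJ : IsIncChain K c J) (n : ℕ) : IsIdealOf (inChain K c T J n) (Rset K c n) :=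
  isIdealOf_spanIn (leadMonSet_subset_Rset T (hJ.1 n).1)

lemma monomial_mem_inChain {T : TermOrder (Fin c × ℕ)} {J : ℕ → Set (PolyR K c)} {n : ℕ}
    {f : PolyR K c} (hf : f ∈ J n) {a : (Fin c × ℕ) →₀ ℕ} (ha : IsLeadMon T f a) :
    monomial a (1 : K) ∈ inChain K c T J n :=
  subset_spanIn _ _ ⟨f, hf, ha.ne_zero, a, ha, rfl⟩

lemma isIdealOf_preimage {m n : ℕ} {I : Set (PolyR K c)} (hI : IsIdealOf I (Rset K c n))
    {p : ℕ → ℕ} (hp : p ∈ IncIn m n) :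
    IsIdealOf {f | f ∈ Rset K c m ∧ incAct K c p f ∈ I} (Rset K c m) := by
  have hR := isIdealOf_Rset (K := K) (c := c) m
  refine ⟨fun f hf => hf.1, ⟨hR.2.1, by simpa using hI.2.1⟩, fun f hf g hg =>
    ⟨hR.2.2.1 f hf.1 g hg.1, ?_⟩, fun a ha f hf => ⟨hR.2.2.2 a ha f hf.1, ?_⟩⟩
  · rw [map_add]
    exact hI.2.2.1 _ hf.2 _ hg.2
  · rw [map_mul]
    exact hI.2.2.2 _ (incAct_mem_Rset hp ha) _ hf.2

lemma IsIncChain.inChain {T : TermOrder (Fin c × ℕ)} (hT : IncCompatible c T)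
    {J : ℕ → Set (PolyR K c)} (hJ : IsIncChain K c J) : IsIncChain K c (inChain K c T J) := by
  refine ⟨isIdealOf_inChain T hJ, ?_⟩
  rintro m n hmn _ ⟨p, hp, f, hf, rfl⟩
  refine (spanIn_subset (isIdealOf_preimage (isIdealOf_inChain T hJ n) hp) ?_ hf).2
  rintro _ ⟨f, hf, -, a, ha, rfl⟩
  refine ⟨monomial_mem_Rset_s6 (mem_Rset_iff_s6.1 ((hJ.1 m).1 hf) a ha.1) 1, ?_⟩
  rw [incAct_monomial]
  exact monomial_mem_inChain (hJ.2 m n hmn ⟨p, hp, f, hf, rfl⟩) (ha.incAct hT hp.1)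

/-- Polynomials of `R_n` all of whose monomials are divisible by a monomial of `B`
form an ideal. -/
lemma isIdealOf_divisible (n : ℕ) (B : Set ((Fin c × ℕ) →₀ ℕ)) :
    IsIdealOf {f : PolyR K c | f ∈ Rset K c n ∧ ∀ a ∈ f.support, ∃ b ∈ B, b ≤ a}
      (Rset K c n) := by
  classical
  have hR := isIdealOf_Rset (K := K) (c := c) n
  refine ⟨fun f hf => hf.1, ⟨hR.2.1, by simp⟩, fun f hf g hg =>
    ⟨hR.2.2.1 f hf.1 g hg.1, fun a ha => ?_⟩, fun r hr f hf =>
    ⟨hR.2.2.2 r hr f hf.1, fun a ha => ?_⟩⟩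
  · rcases Finset.mem_union.1 (support_add ha) with h | h
    exacts [hf.2 a h, hg.2 a h]
  · obtain ⟨x, hx, y, hy, rfl⟩ := Finset.mem_add.1 (support_mul _ _ ha)
    obtain ⟨b, hb, hle⟩ := hf.2 y hy
    exact ⟨b, hb, hle.trans le_add_self⟩

/-- A monomial in the ideal generated by the shifts of the initial ideal of `J_m` is divisible
by a shift of a leading monomial of an element of `J_m`. -/
lemma exists_le_of_mem_spanIn_incOrbit {T : TermOrder (Fin c × ℕ)} {J : ℕ → Set (PolyR K c)}
    (hJ : IsIncChain K c J) {m n : ℕ} {f : PolyR K c}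
    (hf : f ∈ spanIn (Rset K c n) (incOrbit K c m n (inChain K c T J m)))
    {a : (Fin c × ℕ) →₀ ℕ} (ha : a ∈ f.support) :
    ∃ p ∈ IncIn m n, ∃ g ∈ J m, ∃ b, IsLeadMon T g b ∧
      Finsupp.mapDomain (incVar c p) b ≤ a := by
  have key := (spanIn_subset (isIdealOf_divisible n
    {d | ∃ p ∈ IncIn m n, ∃ g ∈ J m, ∃ b, IsLeadMon T g b ∧
      Finsupp.mapDomain (incVar c p) b = d}) ?_ hf).2 a ha
  · obtain ⟨_, ⟨p, hp, g, hg, b, hb, rfl⟩, hle⟩ := key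
    exact ⟨p, hp, g, hg, b, hb, hle⟩
  rintro _ ⟨p, hp, f, hf, rfl⟩
  refine ⟨incAct_mem_Rset hp ((isIdealOf_inChain T hJ m).1 hf), fun a ha => ?_⟩
  obtain ⟨d, hd, rfl⟩ := (mem_support_incAct hp.1).1 ha
  obtain ⟨b, ⟨g, hg, hb⟩, hle⟩ := (spanIn_subset (isIdealOf_divisible m
    {b | ∃ g ∈ J m, IsLeadMon T g b}) (by
      rintro _ ⟨g, hg, -, b, hb, rfl⟩
      refine ⟨monomial_mem_Rset_s6 (mem_Rset_iff_s6.1 ((hJ.1 m).1 hg) b hb.1) 1, fun a ha => ?_⟩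
      obtain rfl := Finset.mem_singleton.1 (support_monomial_subset ha)
      exact ⟨_, ⟨g, hg, hb⟩, le_rfl⟩) hf).2 d hd
  exact ⟨_, ⟨p, hp, g, hg, b, hb, rfl⟩, Finsupp.mapDomain_mono hle⟩

/-- Monomial multiples, with leading monomial in `P`, of shifts of elements of `J_m`. -/
def shiftMultiples (T : TermOrder (Fin c × ℕ)) (J : ℕ → Set (PolyR K c)) (m n : ℕ)
    (P : Set ((Fin c × ℕ) →₀ ℕ)) : Set (PolyR K c) :=
  {x | ∃ p ∈ IncIn m n, ∃ g ∈ J m, ∃ b, IsLeadMon T g b ∧ ∃ k, ExpIn n k ∧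
    k + Finsupp.mapDomain (incVar c p) b ∈ P ∧ x = monomial k 1 * incAct K c p g}

lemma shiftMultiples_mono (T : TermOrder (Fin c × ℕ)) (J : ℕ → Set (PolyR K c)) (m n : ℕ)
    {P Q : Set ((Fin c × ℕ) →₀ ℕ)} (h : P ⊆ Q) :
    shiftMultiples T J m n P ⊆ shiftMultiples T J m n Q := by
  rintro _ ⟨p, hp, g, hg, b, hb, k, hk, hP, rfl⟩
  exact ⟨p, hp, g, hg, b, hb, k, hk, h hP, rfl⟩

section

variable {T : TermOrder (Fin c × ℕ)} {J : ℕ → Set (PolyR K c)} {m n : ℕ}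

lemma exists_isLeadMon_of_mem_shiftMultiples (hT : IncCompatible c T) (hJ : IsIncChain K c J)
    {P : Set ((Fin c × ℕ) →₀ ℕ)} {x : PolyR K c} (hx : x ∈ shiftMultiples T J m n P) :
    ∃ a ∈ P, ExpIn n a ∧ IsLeadMon T x a := by
  obtain ⟨p, hp, g, hg, b, hb, k, hk, hP, rfl⟩ := hx
  exact ⟨_, hP, hk.add ((mem_Rset_iff_s6.1 ((hJ.1 m).1 hg) b hb.1).mapDomain hp),
    (hb.incAct hT hp.1).monomial_mul k⟩

lemma support_subset_of_mem_span (hT : IncCompatible c T) (hJ : IsIncChain K c J)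
    {P : Set ((Fin c × ℕ) →₀ ℕ)} (hP : ∀ a b, T.le a b → b ∈ P → a ∈ P) {x : PolyR K c}
    (hx : x ∈ Submodule.span K (shiftMultiples T J m n P)) : ∀ a ∈ x.support, a ∈ P := by
  classical
  induction hx using Submodule.span_induction with
  | mem x hx =>
    obtain ⟨d, hd, -, hlead⟩ := exists_isLeadMon_of_mem_shiftMultiples hT hJ hx
    exact fun a ha => hP _ _ (hlead.2 a ha) hd
  | zero => simp
  | add x y _ _ hx hy =>
    intro a ha
    rcases Finset.mem_union.1 (support_add ha) with h | h
    exacts [hx a h, hy a h]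
  | smul r x _ hx => exact fun a ha => hx a (support_smul ha)

lemma mem_span_le_of_mem_span (hJ : IsIncChain K c J)
    {P : Set ((Fin c × ℕ) →₀ ℕ)} {x : PolyR K c}
    (hx : x ∈ Submodule.span K (shiftMultiples T J m n P)) :
    x = 0 ∨ ∃ a ∈ P, ExpIn n a ∧
      x ∈ Submodule.span K (shiftMultiples T J m n {b | T.le b a}) := by
  have hmono : ∀ a d, T.le a d →
      Submodule.span K (shiftMultiples T J m n {b | T.le b a}) ≤
        Submodule.span K (shiftMultiples T J m n {b | T.le b d}) := fun a d h =>
    Submodule.span_mono (shiftMultiples_mono T J m n fun b hb => T.trans _ _ _ hb h)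
  induction hx using Submodule.span_induction with
  | mem x hx =>
    obtain ⟨p, hp, g, hg, b, hb, k, hk, hP, rfl⟩ := hx
    exact Or.inr ⟨_, hP, hk.add ((mem_Rset_iff_s6.1 ((hJ.1 m).1 hg) b hb.1).mapDomain hp),
      Submodule.subset_span ⟨p, hp, g, hg, b, hb, k, hk, T.refl _, rfl⟩⟩
  | zero => exact Or.inl rfl
  | add x y _ _ hx hy =>
    rcases hx with rfl | ⟨a, ha, han, hxa⟩
    · simpa using hy
    rcases hy with rfl | ⟨d, hd, hdn, hyd⟩
    · exact Or.inr ⟨a, ha, han, by simpa using hxa⟩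
    rcases T.total a d with h | h
    · exact Or.inr ⟨d, hd, hdn, add_mem (hmono _ _ h hxa) hyd⟩
    · exact Or.inr ⟨a, ha, han, add_mem hxa (hmono _ _ h hyd)⟩
  | smul r x _ hx =>
    rcases hx with rfl | ⟨a, ha, han, hxa⟩
    · simp
    · exact Or.inr ⟨a, ha, han, Submodule.smul_mem _ r hxa⟩

/-- Buchberger's criterion for the shifts of the elements of `J_m`. -/
lemma exists_le_of_mem_span (hT : IncCompatible c T) (hJ : IsIncChain K c J)
    (hS : ∀ a, ∀ x ∈ shiftMultiples T J m n {a}, ∀ y ∈ shiftMultiples T J m n {a}, ∀ r : K,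
      coeff a (x - r • y) = 0 →
        x - r • y ∈ Submodule.span K (shiftMultiples T J m n {b | T.lt b a}))
    {P : Set ((Fin c × ℕ) →₀ ℕ)} {f : PolyR K c}
    (hf : f ∈ Submodule.span K (shiftMultiples T J m n P))
    {d : (Fin c × ℕ) →₀ ℕ} (hd : IsLeadMon T f d) :
    ∃ p ∈ IncIn m n, ∃ g ∈ J m, ∃ b, IsLeadMon T g b ∧
      Finsupp.mapDomain (incVar c p) b ≤ d := by
  have key : ∀ a, ExpIn n a →
      f ∈ Submodule.span K (shiftMultiples T J m n {b | T.le b a}) →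
      ∃ p ∈ IncIn m n, ∃ g ∈ J m, ∃ b, IsLeadMon T g b ∧
        Finsupp.mapDomain (incVar c p) b ≤ d := by
    refine expIn_induction T n fun a ha ih hfa => ?_
    by_cases hlt : f ∈ Submodule.span K (shiftMultiples T J m n {b | T.lt b a})
    · rcases mem_span_le_of_mem_span hJ hlt with rfl | ⟨b, hb, hbn, hfb⟩
      · exact absurd rfl hd.ne_zero
      · exact ih b hbn hb hfb
    · obtain ⟨y, hy⟩ : (shiftMultiples T J m n {a}).Nonempty := by
        by_contra hne
        rw [Set.not_nonempty_iff_eq_empty] at hne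
        refine hlt (Submodule.span_mono ?_ hfa)
        rintro _ ⟨p, hp, g, hg, b, hb, k, hk, hP, rfl⟩
        refine ⟨p, hp, g, hg, b, hb, k, hk, ⟨hP, fun h => ?_⟩, rfl⟩
        have : monomial k 1 * incAct K c p g ∈ shiftMultiples T J m n {a} :=
          ⟨p, hp, g, hg, b, hb, k, hk, h, rfl⟩
        rw [hne] at this
        exact this
      obtain ⟨a', rfl, -, hya⟩ := exists_isLeadMon_of_mem_shiftMultiples hT hJ hy
      have hy0 : coeff a' y ≠ 0 := mem_support_iff.1 hya.1
      have hdec : ∀ x ∈ Submodule.span K (shiftMultiples T J m n {b | T.le b a'}),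
          ∃ r : K, x - r • y ∈
            Submodule.span K (shiftMultiples T J m n {b | T.lt b a'}) := by
        intro x hx
        induction hx using Submodule.span_induction with
        | mem x hx =>
          obtain ⟨p, hp, g, hg, b, hb, k, hk, hP, rfl⟩ := hx
          by_cases h : k + Finsupp.mapDomain (incVar c p) b = a'
          · set x := monomial k 1 * incAct K c p g
            refine ⟨coeff a' x / coeff a' y,
              hS a' x ⟨p, hp, g, hg, b, hb, k, hk, h, rfl⟩ y hy _ ?_⟩
            rw [coeff_sub, coeff_smul, smul_eq_mul, div_mul_cancel₀ _ hy0, sub_self]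
          · exact ⟨0, by
              rw [zero_smul, sub_zero]
              exact Submodule.subset_span ⟨p, hp, g, hg, b, hb, k, hk, ⟨hP, h⟩, rfl⟩⟩
        | zero => exact ⟨0, by simp⟩
        | add x z _ _ hx hz =>
          obtain ⟨r, hr⟩ := hx
          obtain ⟨s, hs⟩ := hz
          refine ⟨r + s, ?_⟩
          rw [add_smul, add_sub_add_comm]
          exact add_mem hr hs
        | smul t x _ hx =>
          obtain ⟨r, hr⟩ := hx
          refine ⟨t * r, ?_⟩
          rw [mul_smul, ← smul_sub]
          exact Submodule.smul_mem _ t hr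
      obtain ⟨r, hr⟩ := hdec f hfa
      have hz : coeff a' (f - r • y) = 0 := by
        by_contra h
        exact (support_subset_of_mem_span hT hJ
          (fun _ _ h h' => T.lt_of_le_of_lt h h') hr a' (mem_support_iff.2 h)).2 rfl
      have hr0 : r ≠ 0 := by
        rintro rfl
        exact hlt (by simpa using hr)
      have hfa' : coeff a' f ≠ 0 := by
        rw [coeff_sub, coeff_smul, sub_eq_zero] at hz
        rw [hz]
        exact mul_ne_zero hr0 hy0
      obtain rfl : d = a' := hd.unique ⟨mem_support_iff.2 hfa',
        support_subset_of_mem_span hT hJ (fun _ _ h h' => T.trans _ _ _ h h') hfa⟩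
      obtain ⟨p, hp, g, hg, b, hb, k, hk, hP, -⟩ := hy
      exact ⟨p, hp, g, hg, b, hb, le_add_self.trans (le_of_eq hP)⟩
  rcases mem_span_le_of_mem_span hJ hf with rfl | ⟨a, -, han, hfa⟩
  · exact absurd rfl hd.ne_zero
  · exact key a han hfa

/-- If the shifts of `J_m` form a Gröbner basis of `J_n`, every element of `J_n` has a standard
representation. -/
lemma mem_span_shiftMultiples (hT : IncCompatible c T) (hJ : IsIncChain K c J) (hmn : m ≤ n)
    (hin : inChain K c T J n ⊆
      spanIn (Rset K c n) (incOrbit K c m n (inChain K c T J m)))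
    {P : Set ((Fin c × ℕ) →₀ ℕ)} (hP : ∀ a b, T.le a b → b ∈ P → a ∈ P) {f : PolyR K c}
    (hf : f ∈ J n) (hfP : ∀ a ∈ f.support, a ∈ P) :
    f ∈ Submodule.span K (shiftMultiples T J m n P) := by
  have key : ∀ a, ExpIn n a → ∀ f ∈ J n, IsLeadMon T f a → (∀ d ∈ f.support, d ∈ P) →
      f ∈ Submodule.span K (shiftMultiples T J m n P) := by
    refine expIn_induction T n fun a ha ih f hf hfa hfP => ?_
    obtain ⟨p, hp, g, hg, b, hb, hle⟩ := exists_le_of_mem_spanIn_incOrbit hJ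
      (hin (monomial_mem_inChain hf hfa)) (a := a) (by
        classical
        rw [mem_support_iff, coeff_monomial, if_pos rfl]
        exact one_ne_zero)
    set k := a - Finsupp.mapDomain (incVar c p) b
    have hk : ExpIn n k := ha.mono tsub_le_self
    have hka : k + Finsupp.mapDomain (incVar c p) b = a := tsub_add_cancel_of_le hle
    set x := monomial k 1 * incAct K c p g with hxdef
    have hx : IsLeadMon T x a := hka ▸ (hb.incAct hT hp.1).monomial_mul k
    have hxJ : x ∈ J n := (hJ.1 n).2.2.2 _ (monomial_mem_Rset_s6 hk 1) _
      (hJ.2 m n hmn ⟨p, hp, g, hg, rfl⟩)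
    have hxspan : x ∈ Submodule.span K (shiftMultiples T J m n P) :=
      Submodule.subset_span ⟨p, hp, g, hg, b, hb, k, hk, hka ▸ hfP a hfa.1, rfl⟩
    set r := coeff a f / coeff a x
    have hz : coeff a (f - r • x) = 0 := by
      rw [coeff_sub, coeff_smul, smul_eq_mul, div_mul_cancel₀ _ (mem_support_iff.1 hx.1),
        sub_self]
    have hle : ∀ d ∈ (f - r • x).support, T.lt d a := by
      classical
      intro d hd
      refine ⟨?_, ?_⟩
      · rcases Finset.mem_union.1 (support_sub _ _ _ hd) with h | h
        exacts [hfa.2 d h, hx.2 d (support_smul h)]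
      · rintro rfl
        exact mem_support_iff.1 hd hz
    have hyJ : f - r • x ∈ J n := (hJ.1 n).sub_smul_mem r hf hxJ
    have hy : f - r • x ∈ Submodule.span K (shiftMultiples T J m n P) := by
      by_cases h0 : f - r • x = 0
      · rw [h0]
        exact zero_mem _
      · obtain ⟨d, hd⟩ := exists_isLeadMon T h0
        exact ih d (mem_Rset_iff_s6.1 ((hJ.1 n).1 hyJ) d hd.1) (hle d hd.1) _ hyJ hd
          fun e he => hP _ _ (hle e he).1 (hfP a hfa.1)
    rw [← sub_add_cancel f (r • x)]
    exact add_mem hy (Submodule.smul_mem _ r hxspan)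
  by_cases h0 : f = 0
  · rw [h0]
    exact zero_mem _
  · obtain ⟨a, ha⟩ := exists_isLeadMon T h0
    exact key a (mem_Rset_iff_s6.1 ((hJ.1 n).1 hf) a ha.1) f hf ha hfP

lemma span_shiftMultiples_subset_spanIn (hJ : IsIncChain K c J)
    (P : Set ((Fin c × ℕ) →₀ ℕ)) :
    (Submodule.span K (shiftMultiples T J m n P) : Set (PolyR K c)) ⊆
      spanIn (Rset K c n) (incOrbit K c m n (J m)) := by
  have hI := isIdealOf_spanIn (incOrbit_subset_Rset (n := n) (hJ.1 m).1)
  intro x hx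
  induction hx using Submodule.span_induction with
  | mem x hx =>
    obtain ⟨p, hp, g, hg, b, hb, k, hk, hP, rfl⟩ := hx
    exact hI.2.2.2 _ (monomial_mem_Rset_s6 hk 1) _ (subset_spanIn _ _ ⟨p, hp, g, hg, rfl⟩)
  | zero => exact hI.2.1
  | add x y _ _ hx hy => exact hI.2.2.1 _ hx _ hy
  | smul r x _ hx => exact hI.smul_mem r hx

lemma monomial_mul_mem_span {k : (Fin c × ℕ) →₀ ℕ} (hk : ExpIn n k) (r : K) {f : PolyR K c}
    (hf : f ∈ Submodule.span K (shiftMultiples T J m n Set.univ)) :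
    monomial k r * f ∈ Submodule.span K (shiftMultiples T J m n Set.univ) := by
  induction hf using Submodule.span_induction with
  | mem x hx =>
    obtain ⟨p, hp, g, hg, b, hb, l, hl, -, rfl⟩ := hx
    rw [← mul_assoc, monomial_mul, mul_one, ← mul_one r, ← smul_eq_mul r 1, ← smul_monomial,
      smul_mul_assoc]
    exact Submodule.smul_mem _ _
      (Submodule.subset_span ⟨p, hp, g, hg, b, hb, k + l, hk.add hl, trivial, rfl⟩)
  | zero => simp
  | add x y _ _ hx hy => rw [mul_add]; exact add_mem hx hy
  | smul s x _ hx => rw [mul_smul_comm]; exact Submodule.smul_mem _ s hx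

lemma spanIn_subset_span_shiftMultiples (hJ : IsIncChain K c J) :
    spanIn (Rset K c n) (incOrbit K c m n (J m)) ⊆
      (Submodule.span K (shiftMultiples T J m n Set.univ) : Set (PolyR K c)) := by
  refine spanIn_subset ⟨?_, zero_mem _, fun f hf g hg => add_mem hf hg, ?_⟩ ?_
  · exact (span_shiftMultiples_subset_spanIn hJ _).trans
      (isIdealOf_spanIn (incOrbit_subset_Rset (hJ.1 m).1)).1
  · intro a ha f hf
    rw [a.as_sum, Finset.sum_mul]
    exact sum_mem fun k hk => monomial_mul_mem_span (mem_Rset_iff_s6.1 ha k hk) _ hf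
  · rintro _ ⟨p, hp, g, hg, rfl⟩
    by_cases h0 : g = 0
    · rw [h0, map_zero]
      exact zero_mem _
    obtain ⟨b, hb⟩ := exists_isLeadMon T h0
    refine Submodule.subset_span ⟨p, hp, g, hg, b, hb, 0, fun v hv => absurd rfl hv, trivial, ?_⟩
    rw [monomial_zero', C_1, one_mul]

lemma monomial_mul_incAct_mem_span (hT : IncCompatible c T) {M : ℕ} {s : ℕ → ℕ}
    (hs : s ∈ IncIn M n) {l t : (Fin c × ℕ) →₀ ℕ} (ht : ExpIn n t) {f : PolyR K c}
    (hf : f ∈ Submodule.span K (shiftMultiples T J m M {b | T.lt b l})) :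
    monomial t 1 * incAct K c s f ∈ Submodule.span K
      (shiftMultiples T J m n {b | T.lt b (t + Finsupp.mapDomain (incVar c s) l)}) := by
  induction hf using Submodule.span_induction with
  | mem x hx =>
    obtain ⟨p, hp, g, hg, b, hb, k, hk, hP, rfl⟩ := hx
    refine Submodule.subset_span ⟨s ∘ p, incIn_comp hs hp, g, hg, b, hb,
      t + Finsupp.mapDomain (incVar c s) k, ht.add (hk.mapDomain hs), ?_, ?_⟩
    · rw [add_assoc, ← mapDomain_incVar_comp, ← Finsupp.mapDomain_add]
      exact ⟨T.add_left t (hT s hs.1 _ _ hP.1), fun h => hP.2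
        (Finsupp.mapDomain_injective (incVar_injective hs.1) (add_left_cancel h))⟩
    · rw [map_mul, incAct_incAct, incAct_monomial, ← mul_assoc, monomial_mul, mul_one]
  | zero => simp
  | add x y _ _ hx hy => rw [map_add, mul_add]; exact add_mem hx hy
  | smul r x _ hx => rw [map_smul, mul_smul_comm]; exact Submodule.smul_mem _ r hx

/-- The S-polynomials of shifts of elements of `J_m` are shifts of S-polynomials lying in
`J_M` as soon as `2m ≤ M`, so standard representations in `J_M` can be transported. -/
lemma sub_smul_mem_span (hT : IncCompatible c T) (hJ : IsIncChain K c J) {M : ℕ}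
    (hM : 2 * m ≤ M) (hn : M ≤ n)
    (hin : inChain K c T J M ⊆
      spanIn (Rset K c M) (incOrbit K c m M (inChain K c T J m)))
    (a : (Fin c × ℕ) →₀ ℕ) (x : PolyR K c) (hx : x ∈ shiftMultiples T J m n {a})
    (y : PolyR K c) (hy : y ∈ shiftMultiples T J m n {a}) (r : K)
    (hxy : coeff a (x - r • y) = 0) :
    x - r • y ∈ Submodule.span K (shiftMultiples T J m n {b | T.lt b a}) := by
  have hmM : m ≤ M := by omega
  obtain ⟨p, hp, f, hf, b, hb, k, hk, hka, rfl⟩ := hx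
  obtain ⟨q, hq, g, hg, d, hd, k', hk', hka', rfl⟩ := hy
  rw [Set.mem_singleton_iff] at hka hka'
  obtain ⟨s, hs, p', hp', q', hq', hpp, hqq⟩ := exists_common_factor hp hq hM hn
  have hfR := (hJ.1 m).1 hf
  have hgR := (hJ.1 m).1 hg
  have hbm := mem_Rset_iff_s6.1 hfR b hb.1
  have hdm := mem_Rset_iff_s6.1 hgR d hd.1
  rw [mapDomain_incVar_congr hpp hbm, ← mapDomain_incVar_comp] at hka
  rw [mapDomain_incVar_congr hqq hdm, ← mapDomain_incVar_comp] at hka'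
  rw [incAct_congr_s6 hpp hfR, incAct_congr_s6 hqq hgR, ← incAct_incAct, ← incAct_incAct] at hxy ⊢
  set b' := Finsupp.mapDomain (incVar c p') b
  set d' := Finsupp.mapDomain (incVar c q') d
  have hb' : ExpIn M b' := hbm.mapDomain hp'
  have hd' : ExpIn M d' := hdm.mapDomain hq'
  set f' := incAct K c p' f
  set g' := incAct K c q' g
  have hf' : IsLeadMon T f' b' := hb.incAct hT hp'.1
  have hg' : IsLeadMon T g' d' := hd.incAct hT hq'.1
  have hsinj := incVar_injective (c := c) hs.1
  set l := b' ⊔ d'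
  have hl : ExpIn M l := hb'.sup hd'
  have hla : Finsupp.mapDomain (incVar c s) l ≤ a := by
    intro v
    by_cases hv : v ∈ Set.range (incVar c s)
    · obtain ⟨w, rfl⟩ := hv
      have h1 := DFunLike.congr_fun hka (incVar c s w)
      have h2 := DFunLike.congr_fun hka' (incVar c s w)
      rw [Finsupp.add_apply, Finsupp.mapDomain_apply hsinj] at h1 h2
      rw [Finsupp.mapDomain_apply hsinj, Finsupp.sup_apply]
      exact sup_le (by omega) (by omega)
    · rw [mapDomain_incVar_eq_zero hv]
      exact Nat.zero_le _
  have hbl : l - b' + b' = l := tsub_add_cancel_of_le le_sup_left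
  have hdl : l - d' + d' = l := tsub_add_cancel_of_le le_sup_right
  obtain ⟨t, hta⟩ : ∃ t, t + Finsupp.mapDomain (incVar c s) l = a :=
    ⟨_, tsub_add_cancel_of_le hla⟩
  have ha : ExpIn n a := hka ▸ hk.add (hb'.mapDomain hs)
  have ht : ExpIn n t := ha.mono (hta ▸ le_self_add)
  have htk : t + Finsupp.mapDomain (incVar c s) (l - b') = k := by
    refine add_right_cancel (b := Finsupp.mapDomain (incVar c s) b') ?_
    rw [hka, add_assoc, ← Finsupp.mapDomain_add, hbl, hta]
  have htk' : t + Finsupp.mapDomain (incVar c s) (l - d') = k' := by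
    refine add_right_cancel (b := Finsupp.mapDomain (incVar c s) d') ?_
    rw [hka', add_assoc, ← Finsupp.mapDomain_add, hdl, hta]
  set F := monomial (l - b') 1 * f' - r • (monomial (l - d') 1 * g')
  have hF : monomial t 1 * incAct K c s F =
      monomial k 1 * incAct K c s f' - r • (monomial k' 1 * incAct K c s g') := by
    rw [map_sub, map_smul, map_mul, map_mul, incAct_monomial, incAct_monomial, mul_sub,
      mul_smul_comm, ← mul_assoc, ← mul_assoc, monomial_mul, monomial_mul, mul_one, htk, htk']
  have hFJ : F ∈ J M := (hJ.1 M).sub_smul_mem r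
    ((hJ.1 M).2.2.2 _ (monomial_mem_Rset_s6 (hl.mono tsub_le_self) 1) _
      (hJ.2 m M hmM ⟨p', hp', f, hf, rfl⟩))
    ((hJ.1 M).2.2.2 _ (monomial_mem_Rset_s6 (hl.mono tsub_le_self) 1) _
      (hJ.2 m M hmM ⟨q', hq', g, hg, rfl⟩))
  have hFl : coeff l F = 0 := by
    rw [← hF, ← hta, coeff_monomial_mul, one_mul, incAct,
      coeff_rename_mapDomain _ hsinj] at hxy
    exact hxy
  have hlead := hf'.monomial_mul (l - b')
  have hlead' := hg'.monomial_mul (l - d')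
  rw [hbl] at hlead
  rw [hdl] at hlead'
  have hFlt : ∀ e ∈ F.support, T.lt e l := by
    classical
    intro e he
    refine ⟨?_, ?_⟩
    · rcases Finset.mem_union.1 (support_sub _ _ _ he) with h | h
      exacts [hlead.2 e h, hlead'.2 e (support_smul h)]
    · rintro rfl
      exact mem_support_iff.1 he hFl
  rw [← hF, ← hta]
  exact monomial_mul_incAct_mem_span hT hs ht
    (mem_span_shiftMultiples hT hJ hmM hin (P := {b | T.lt b l})
      (fun _ _ h h' => T.lt_of_le_of_lt h h') hFJ hFlt)

end

lemma stabSet_inChain_subset {T : TermOrder (Fin c × ℕ)} (hT : IncCompatible c T)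
    {J : ℕ → Set (PolyR K c)} (hJ : IsIncChain K c J) :
    stabSet K c (inChain K c T J) ⊆ stabSet K c J := by
  intro M hM n hn
  refine Set.Subset.antisymm (spanIn_subset (hJ.1 n) (hJ.2 M n hn)) fun f hf => ?_
  exact span_shiftMultiples_subset_spanIn hJ Set.univ
    (mem_span_shiftMultiples hT hJ hn (hM n hn).ge (fun _ _ _ _ => trivial) hf
      fun _ _ => trivial)

lemma mem_stabSet_inChain {T : TermOrder (Fin c × ℕ)} (hT : IncCompatible c T)
    {J : ℕ → Set (PolyR K c)} (hJ : IsIncChain K c J) {N M : ℕ} (hN : N ∈ stabSet K c J)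
    (hM : 2 * N ≤ M)
    (hin : inChain K c T J M ⊆
      spanIn (Rset K c M) (incOrbit K c N M (inChain K c T J N))) :
    M ∈ stabSet K c (inChain K c T J) := by
  intro n hn
  have hC := hJ.inChain hT
  have hNM : N ≤ M := by omega
  refine Set.Subset.antisymm (spanIn_subset (hC.1 n) (hC.2 M n hn)) ?_
  have hI := isIdealOf_spanIn (incOrbit_subset_Rset (n := n) (hC.1 M).1)
  refine spanIn_subset hI ?_
  rintro _ ⟨f, hf, -, a, ha, rfl⟩
  have han := mem_Rset_iff_s6.1 ((hJ.1 n).1 hf) a ha.1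
  rw [← hN n (hNM.trans hn)] at hf
  obtain ⟨p, hp, g, hg, b, hb, hle⟩ := exists_le_of_mem_span hT hJ
    (sub_smul_mem_span hT hJ hM hn hin) (spanIn_subset_span_shiftMultiples hJ hf) ha
  obtain ⟨s, hs, p', hp', hpp⟩ := exists_incIn_factor hp hNM hn
  have hbN := mem_Rset_iff_s6.1 ((hJ.1 N).1 hg) b hb.1
  have key : monomial (a - Finsupp.mapDomain (incVar c p) b) (1 : K) *
      incAct K c s (monomial (Finsupp.mapDomain (incVar c p') b) 1) = monomial a 1 := by
    rw [incAct_monomial, mapDomain_incVar_comp, ← mapDomain_incVar_congr hpp hbN, monomial_mul,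
      mul_one, tsub_add_cancel_of_le hle]
  rw [← key]
  exact hI.2.2.2 _ (monomial_mem_Rset_s6 (han.mono tsub_le_self) 1) _ (subset_spanIn _ _
    ⟨s, hs, _, monomial_mem_inChain (hJ.2 N M hNM ⟨p', hp', g, hg, rfl⟩)
      (hb.incAct hT hp'.1), rfl⟩)

end Helpers

/-- **Proposition (Statement 6).** Let `J∘` be an `Inc(ℕ)`-invariant ideal chain in `R` and
`N ≥ Ind(J∘)`. Then for every `Inc(ℕ)`-compatible term order `⪯`, the identity
`in_⪯(J_{2N}) = ⟨Inc(ℕ)_{N,2N} · in_⪯(J_N)⟩_{R_{2N}}` implies `Ind(in_⪯(J∘)) ≤ 2N`. -/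
theorem ind_inChain_le_two_mul (K : Type*) [Field K] (c : ℕ) (hc : 0 < c)
    (J : ℕ → Set (PolyR K c)) (hJ : IsIncChain K c J)
    (N : ℕ) (hN : Ind K c J ≤ N)
    (T : TermOrder (Fin c × ℕ)) (hT : IncCompatible c T)
    (heq : inChain K c T J (2 * N) =
      spanIn (Rset K c (2 * N)) (incOrbit K c N (2 * N) (inChain K c T J N))) :
    Ind K c (inChain K c T J) ≤ 2 * N := by
  rcases (stabSet K c (inChain K c T J)).eq_empty_or_nonempty with h | ⟨M, hM⟩
  · rw [Ind, h, Nat.sInf_empty]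
    exact Nat.zero_le _
  · have hInd : Ind K c J ∈ stabSet K c J := Nat.sInf_mem ⟨M, stabSet_inChain_subset hT hJ hM⟩
    exact Nat.sInf_le (mem_stabSet_inChain hT hJ (stabSet_mono hJ hInd hN) le_rfl heq.le)
end
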